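/- arXiv:1210.8012 — 2 statements merged into one kernel-verified Lean document; each statement's English description precedes it below -/
import Mathlib

section
/- Let c : ℤ³ → ℂ³ be a family of Fourier coefficients satisfying c(0) = 0, the reality condition c(−ξ) = conj(c(ξ)) for all ξ ∈ ℤ³, the divergence-free condition ξ · c(ξ) = 0 for all ξ ∈ ℤ³, and the absolute summability ∑_{ξ∈ℤ³} |c(ξ)| < ∞. Define the 3×3 complex matrix α by its action α·b = ∑_{ξ∈ℤ³, ξ≠0} |ξ|^{-2} · c(−ξ) × (iξ × (c(ξ) × b)) for b ∈ ℂ³ (where × is the cross product extended bilinearly to ℂ³). Then all entries of α are real and α is a symmetric matrix. -/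
open scoped ComplexConjugate

/-- If `x` is orthogonal to `u`, the triple product `a × (t x × (u × b))` collapses. -/
lemma crossProduct_smul_crossProduct_of_dotProduct_eq_zero {R : Type*} [CommRing R]
    (a x u b : Fin 3 → R) (t : R) (h : x ⬝ᵥ u = 0) :
    crossProduct a (crossProduct (t • x) (crossProduct u b)) =
      (t * (x ⬝ᵥ b)) • crossProduct a u := by
  have key : crossProduct (t • x) (crossProduct u b) = (t * (x ⬝ᵥ b)) • u := by
    simp only [Matrix.vec3_dotProduct] at h ⊢
    simp only [cross_apply]
    ext i
    fin_cases i <;> simp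
    · linear_combination -t * b 0 * h
    · linear_combination -t * b 1 * h
    · linear_combination -t * b 2 * h
  rw [key, map_smul]

/-- The cross product of two vectors orthogonal to `x` is parallel to `x`. -/
lemma crossProduct_mul_comm_of_dotProduct_eq_zero {R : Type*} [CommRing R]
    (x u v : Fin 3 → R) (hu : x ⬝ᵥ u = 0) (hv : x ⬝ᵥ v = 0) (i j : Fin 3) :
    crossProduct u v i * x j = crossProduct u v j * x i := by
  simp only [Matrix.vec3_dotProduct] at hu hv
  simp only [cross_apply]
  fin_cases i <;> fin_cases j <;> simp
  · linear_combination v 2 * hu - u 2 * hv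
  · linear_combination u 1 * hv - v 1 * hu
  · linear_combination u 2 * hv - v 2 * hu
  · linear_combination v 0 * hu - u 0 * hv
  · linear_combination v 1 * hu - u 1 * hv
  · linear_combination u 0 * hv - v 0 * hu

lemma re_crossProduct_conj_self (u : Fin 3 → ℂ) (i : Fin 3) :
    (crossProduct (fun k => conj (u k)) u i).re = 0 := by
  simp only [cross_apply]
  fin_cases i <;> simp <;> ring

lemma norm_crossProduct_apply_le (u v : Fin 3 → ℂ) (i : Fin 3) :
    ‖crossProduct u v i‖ ≤ 2 * (‖u‖ * ‖v‖) := by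
  have h (a b d e : Fin 3) : ‖u a * v b - u d * v e‖ ≤ 2 * (‖u‖ * ‖v‖) := by
    calc ‖u a * v b - u d * v e‖ ≤ ‖u a‖ * ‖v b‖ + ‖u d‖ * ‖v e‖ := by
          simpa only [norm_mul] using norm_sub_le (u a * v b) (u d * v e)
      _ ≤ ‖u‖ * ‖v‖ + ‖u‖ * ‖v‖ := by
          gcongr <;> exact norm_le_pi_norm _ _
      _ = 2 * (‖u‖ * ‖v‖) := by ring
  rw [cross_apply]
  fin_cases i
  · exact h 1 2 2 1
  · exact h 2 0 0 2
  · exact h 0 1 1 0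

lemma norm_inv_sum_sq_mul_le_one (ξ : Fin 3 → ℤ) (j : Fin 3) :
    ‖(∑ i : Fin 3, ((ξ i : ℝ)) ^ 2)⁻¹ * (ξ j : ℝ)‖ ≤ 1 := by
  have hle : |(ξ j : ℝ)| ≤ ∑ i : Fin 3, ((ξ i : ℝ)) ^ 2 := by
    calc |(ξ j : ℝ)| ≤ (ξ j : ℝ) ^ 2 := by
          have h := Int.le_self_sq |ξ j|
          rw [sq_abs] at h
          exact_mod_cast h
      _ ≤ _ := Finset.single_le_sum (f := fun i => ((ξ i : ℝ)) ^ 2)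
          (fun i _ => sq_nonneg _) (Finset.mem_univ j)
  have hnonneg : 0 ≤ ∑ i : Fin 3, ((ξ i : ℝ)) ^ 2 := (abs_nonneg _).trans hle
  rw [norm_mul, norm_inv, Real.norm_of_nonneg hnonneg, Real.norm_eq_abs, inv_mul_eq_div]
  exact div_le_one_of_le₀ hle hnonneg

/-- The contribution of the frequency `ξ` with coefficient `u` to the alpha-effect matrix. -/
noncomputable def alphaMode (ξ : Fin 3 → ℤ) (u : Fin 3 → ℂ) (i j : Fin 3) : ℂ :=
  ((∑ k : Fin 3, ((ξ k : ℝ)) ^ 2)⁻¹ * (ξ j : ℝ) : ℝ) *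
    (Complex.I * crossProduct (fun k => conj (u k)) u i)

lemma alphaMode_im (ξ : Fin 3 → ℤ) (u : Fin 3 → ℂ) (i j : Fin 3) :
    (alphaMode ξ u i j).im = 0 := by
  rw [alphaMode, Complex.im_ofReal_mul, Complex.I_mul_im, re_crossProduct_conj_self, mul_zero]

lemma norm_alphaMode_le (ξ : Fin 3 → ℤ) (u : Fin 3 → ℂ) (i j : Fin 3) :
    ‖alphaMode ξ u i j‖ ≤ 2 * ‖u‖ ^ 2 := by
  have hconj : ‖fun k => conj (u k)‖ = ‖u‖ := norm_star u
  have h := norm_crossProduct_apply_le (fun k => conj (u k)) u i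
  rw [hconj, ← sq] at h
  rw [alphaMode, norm_mul, norm_mul, Complex.norm_I, one_mul, Complex.norm_real]
  exact (mul_le_of_le_one_left (norm_nonneg _) (norm_inv_sum_sq_mul_le_one ξ j)).trans h

lemma alphaMode_comm (ξ : Fin 3 → ℤ) (u : Fin 3 → ℂ)
    (h : (fun k => (ξ k : ℂ)) ⬝ᵥ u = 0) (i j : Fin 3) :
    alphaMode ξ u i j = alphaMode ξ u j i := by
  have hconj : (fun k => (ξ k : ℂ)) ⬝ᵥ (fun k => conj (u k)) = 0 := by
    simpa [dotProduct] using congrArg conj h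
  have hcomm := crossProduct_mul_comm_of_dotProduct_eq_zero _ _ _ hconj h i j
  simp only [alphaMode]
  push_cast
  linear_combination ((∑ k : Fin 3, ((ξ k : ℂ)) ^ 2)⁻¹ * Complex.I) * hcomm

/-- The alpha-effect matrix, defined through its action on vectors via the
Fourier coefficients `c` of the velocity field, is real and symmetric. -/
theorem alpha_matrix_real_symmetric
    (c : (Fin 3 → ℤ) → (Fin 3 → ℂ))
    (hzero : c 0 = 0)
    (hreal : ∀ ξ : Fin 3 → ℤ, c (-ξ) = fun i => conj (c ξ i))
    (hdiv : ∀ ξ : Fin 3 → ℤ, (∑ i : Fin 3, (ξ i : ℂ) * c ξ i) = 0)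
    (hsum : Summable fun ξ : Fin 3 → ℤ => ‖c ξ‖)
    (α : Matrix (Fin 3) (Fin 3) ℂ)
    (hα : ∀ b : Fin 3 → ℂ,
      α.mulVec b = ∑' ξ : Fin 3 → ℤ,
        if ξ = 0 then 0 else
          ((∑ i : Fin 3, ((ξ i : ℝ)) ^ 2)⁻¹ : ℝ) •
            crossProduct (c (-ξ))
              (crossProduct (Complex.I • fun i => (ξ i : ℂ))
                (crossProduct (c ξ) b))) :
    (∀ i j : Fin 3, (α i j).im = 0) ∧ α.IsSymm := by
  have hsummable (i j : Fin 3) : Summable fun ξ => alphaMode ξ (c ξ) i j := by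
    have hsq : Summable fun ξ => ‖c ξ‖ ^ 2 := by
      simpa only [sq, Function.comp_def] using (hsum.mul_of_nonneg hsum (fun _ => norm_nonneg _)
        fun _ => norm_nonneg _).comp_injective (i := fun ξ => (ξ, ξ))
        fun _ _ h => congrArg Prod.fst h
    exact (hsq.mul_left 2).of_norm_bounded fun ξ => norm_alphaMode_le ξ (c ξ) i j
  have hentry (i j : Fin 3) : α i j = ∑' ξ, alphaMode ξ (c ξ) i j := by
    have hcol : α.col j = ∑' ξ, fun k => alphaMode ξ (c ξ) k j := by
      rw [← Matrix.mulVec_single_one, hα]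
      refine tsum_congr fun ξ => ?_
      split_ifs with hξ
      · ext k
        simp [alphaMode, hξ]
      · rw [crossProduct_smul_crossProduct_of_dotProduct_eq_zero _ _ _ _ _ (hdiv ξ), hreal]
        ext k
        simp only [alphaMode, Pi.smul_apply, dotProduct_single_one, smul_eq_mul,
          Complex.real_smul]
        push_cast
        ring
    have happly := congrFun hcol i
    rwa [tsum_apply (Pi.summable.2 fun k => hsummable k j)] at happly
  refine ⟨fun i j => ?_, Matrix.IsSymm.ext fun i j => ?_⟩
  · rw [hentry, Complex.im_tsum (hsummable i j)]
    simp only [alphaMode_im, tsum_zero]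
  · rw [hentry, hentry]
    exact tsum_congr fun ξ => alphaMode_comm ξ (c ξ) (hdiv ξ) j i
end

section
/- Let ρ, η, A, K, δ > 0 and let v : [0, ∞) → [0, ∞) be continuous with v(0) = 0. Assume that for every t ≥ 0 such that v(s) ≤ (1/2)·δ·e^{ρs}·A for all s ∈ [0, t], one has v(t) ≤ K·δ^{1+η}·e^{(1+η)ρt}. Suppose T := sup{t ≥ 0 : v(s) ≤ (1/2)·δ·e^{ρs}·A for all s ∈ [0, t]} is finite, and let t_δ = (1/(ηρ))·ln(A/(2K(1+η)δ^η)). If t_δ ≥ 0, then t_δ ≤ T and δ·e^{ρ t_δ}·A − v(t_δ) ≥ (η/(1+η))·A·(A/(2K(1+η)))^{1/η}. In particular, the lower bound (η/(1+η))·A·(A/(2K(1+η)))^{1/η} does not depend on δ. -/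
/-- Continuity (bootstrap) principle: if a continuous function starts nonpositive and is strictly
negative at every time up to which it is nonpositive, then it stays negative. -/
theorem neg_of_bootstrap {h : ℝ → ℝ} {a b : ℝ} (hc : ContinuousOn h (Set.Icc a b))
    (ha : h a ≤ 0)
    (hstep : ∀ t ∈ Set.Icc a b, (∀ s ∈ Set.Icc a t, h s ≤ 0) → h t < 0) :
    ∀ t ∈ Set.Icc a b, h t < 0 := by
  have exists_zero : ∀ t ∈ Set.Icc a b, 0 < h t → ∃ s ∈ Set.Icc a t, h s = 0 := by
    intro t ht hpos
    exact intermediate_value_Icc ht.1 (hc.mono (Set.Icc_subset_Icc_right ht.2)) ⟨ha, hpos.le⟩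
  have nonpos : ∀ t ∈ Set.Icc a b, h t ≤ 0 := by
    intro t ht
    by_contra! hpos
    obtain ⟨s, hs, hs0⟩ := exists_zero t ht hpos
    have hcl : IsClosed (Set.Icc a b ∩ h ⁻¹' {0}) :=
      hc.preimage_isClosed_of_isClosed isClosed_Icc isClosed_singleton
    have hcpt : IsCompact (Set.Icc a b ∩ h ⁻¹' {0}) :=
      isCompact_Icc.of_isClosed_subset hcl Set.inter_subset_left
    obtain ⟨m, ⟨hm, hm0⟩, hmin⟩ := hcpt.exists_isLeast ⟨s, ⟨hs.1, hs.2.trans ht.2⟩, hs0⟩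
    refine (hstep m hm fun r hr => ?_).ne hm0
    by_contra! hr0
    obtain ⟨q, hq, hq0⟩ := exists_zero r ⟨hr.1, hr.2.trans hm.2⟩ hr0
    have hmq : m ≤ q := hmin ⟨⟨hq.1, hq.2.trans (hr.2.trans hm.2)⟩, hq0⟩
    have hqr : q = r := le_antisymm hq.2 (hr.2.trans hmq)
    exact hr0.ne' (hqr ▸ hq0)
  exact fun t ht => hstep t ht fun s hs => nonpos s ⟨hs.1, hs.2.trans ht.2⟩


/-- Core of the nonlinear instability argument: at the time `t_δ`, the
linear growing mode dominates the correction `v` by an amount bounded below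
independently of the initial amplitude `δ`. -/
theorem nonlinear_instability_lower_bound
    (ρ η A K δ : ℝ) (hρ : 0 < ρ) (hη : 0 < η) (hA : 0 < A) (hK : 0 < K)
    (hδ : 0 < δ)
    (v : ℝ → ℝ)
    (hv_cont : ContinuousOn v (Set.Ici (0 : ℝ)))
    (hv_nonneg : ∀ t : ℝ, 0 ≤ t → 0 ≤ v t)
    (hv0 : v 0 = 0)
    (hboot : ∀ t : ℝ, 0 ≤ t →
      (∀ s : ℝ, 0 ≤ s → s ≤ t → v s ≤ 1 / 2 * δ * Real.exp (ρ * s) * A) →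
      v t ≤ K * δ ^ (1 + η) * Real.exp ((1 + η) * ρ * t))
    (T : ℝ)
    (hbdd : BddAbove {t : ℝ | 0 ≤ t ∧
      ∀ s : ℝ, 0 ≤ s → s ≤ t → v s ≤ 1 / 2 * δ * Real.exp (ρ * s) * A})
    (hT : T = sSup {t : ℝ | 0 ≤ t ∧
      ∀ s : ℝ, 0 ≤ s → s ≤ t → v s ≤ 1 / 2 * δ * Real.exp (ρ * s) * A})
    (tδ : ℝ)
    (htδ : tδ = 1 / (η * ρ) * Real.log (A / (2 * K * (1 + η) * δ ^ η)))
    (htδ0 : 0 ≤ tδ) :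
    tδ ≤ T ∧
      η / (1 + η) * A * (A / (2 * K * (1 + η))) ^ (1 / η)
        ≤ δ * Real.exp (ρ * tδ) * A - v tδ := by
  have hη1 : 0 < 1 + η := by positivity
  have hδη : 0 < δ ^ η := Real.rpow_pos_of_pos hδ η
  set c := A / (2 * K * (1 + η)) with hc
  have hc0 : 0 < c := by positivity
  have hKc : K * c = A / (2 * (1 + η)) := by rw [hc]; field_simp
  have hexp : δ ^ η * Real.exp (η * ρ * tδ) = c := by
    have hlog : η * ρ * tδ = Real.log (A / (2 * K * (1 + η) * δ ^ η)) := by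
      rw [htδ]; field_simp
    rw [hlog, Real.exp_log (by positivity), hc]
    field_simp
  have hB : δ * Real.exp (ρ * tδ) = c ^ (1 / η) := by
    rw [← hexp, Real.mul_rpow hδη.le (Real.exp_pos _).le, ← Real.rpow_mul hδ.le,
      ← Real.exp_mul, mul_one_div_cancel hη.ne', Real.rpow_one]
    congr 2
    field_simp
  have hbound : ∀ t, 0 ≤ t → t ≤ tδ →
      (∀ s : ℝ, 0 ≤ s → s ≤ t → v s ≤ 1 / 2 * δ * Real.exp (ρ * s) * A) →
      v t ≤ δ * Real.exp (ρ * t) * (A / (2 * (1 + η))) := by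
    intro t ht htt hs
    calc v t ≤ K * δ ^ (1 + η) * Real.exp ((1 + η) * ρ * t) := hboot t ht hs
      _ = δ * Real.exp (ρ * t) * (K * (δ ^ η * Real.exp (η * ρ * t))) := by
        rw [Real.rpow_add hδ, Real.rpow_one,
          show (1 + η) * ρ * t = ρ * t + η * ρ * t by ring, Real.exp_add]
        ring
      _ ≤ δ * Real.exp (ρ * t) * (K * (δ ^ η * Real.exp (η * ρ * tδ))) := by gcongr
      _ = δ * Real.exp (ρ * t) * (A / (2 * (1 + η))) := by rw [hexp, hKc]
  have hfrac : A / (2 * (1 + η)) < A / 2 := by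
    apply div_lt_div_of_pos_left hA <;> linarith
  have hneg := neg_of_bootstrap (a := 0) (b := tδ)
    (h := fun s => v s - 1 / 2 * δ * Real.exp (ρ * s) * A)
    ((hv_cont.mono Set.Icc_subset_Ici_self).sub (by fun_prop))
    (by simp only [hv0, zero_sub, Left.neg_nonpos_iff]; positivity)
    (by
      intro t ht hs
      have hvt := hbound t ht.1 ht.2 fun s h0 h1 => sub_nonpos.1 (hs s ⟨h0, h1⟩)
      have hlt := mul_lt_mul_of_pos_left hfrac (mul_pos hδ (Real.exp_pos (ρ * t)))
      linarith)
  have hmem : ∀ s : ℝ, 0 ≤ s → s ≤ tδ → v s ≤ 1 / 2 * δ * Real.exp (ρ * s) * A :=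
    fun s h0 h1 => (sub_neg.1 (hneg s ⟨h0, h1⟩)).le
  refine ⟨hT ▸ le_csSup hbdd ⟨htδ0, hmem⟩, ?_⟩
  have hv := hbound tδ htδ0 le_rfl hmem
  rw [hB] at hv ⊢
  have hB0 : 0 < c ^ (1 / η) := Real.rpow_pos_of_pos hc0 _
  have hsplit : c ^ (1 / η) * A - c ^ (1 / η) * (A / (2 * (1 + η))) =
      η / (1 + η) * A * c ^ (1 / η) + c ^ (1 / η) * (A / (2 * (1 + η))) := by
    field_simp
    ring
  have hrem : 0 < c ^ (1 / η) * (A / (2 * (1 + η))) := by positivity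
  linarith
end
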